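/- Let Γ be a finite connected non-complete graph of prime valency p that is 2-geodesic transitive but not 2-arc transitive. Then for every pair of adjacent vertices v,u, the number of neighbours of u that are at distance 2 from v equals (p-1)/2. -/

import Mathlib

open SimpleGraph

/-- `Γ` is arc transitive: its automorphism group is transitive on ordered pairs
of adjacent vertices. -/
def ArcTransitive {V : Type*} (Γ : SimpleGraph V) : Prop :=
  ∀ ⦃v u v' u' : V⦄, Γ.Adj v u → Γ.Adj v' u' →
    ∃ φ : Γ ≃g Γ, φ v = v' ∧ φ u = u'

/-- `(v,u,w)` is a 2-arc of `Γ`. -/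
def Is2Arc {V : Type*} (Γ : SimpleGraph V) (v u w : V) : Prop :=
  Γ.Adj v u ∧ Γ.Adj u w ∧ v ≠ w

/-- `(v,u,w)` is a 2-geodesic of `Γ`: a 2-arc with `v`, `w` non-adjacent. -/
def Is2Geodesic {V : Type*} (Γ : SimpleGraph V) (v u w : V) : Prop :=
  Γ.Adj v u ∧ Γ.Adj u w ∧ v ≠ w ∧ ¬ Γ.Adj v w

/-- `Γ` is 2-arc transitive: arc transitive and transitive on 2-arcs. -/
def TwoArcTransitive {V : Type*} (Γ : SimpleGraph V) : Prop :=
  ArcTransitive Γ ∧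
  ∀ ⦃v u w v' u' w' : V⦄, Is2Arc Γ v u w → Is2Arc Γ v' u' w' →
    ∃ φ : Γ ≃g Γ, φ v = v' ∧ φ u = u' ∧ φ w = w'

/-- `Γ` is 2-geodesic transitive: arc transitive and transitive on 2-geodesics. -/
def TwoGeodesicTransitive {V : Type*} (Γ : SimpleGraph V) : Prop :=
  ArcTransitive Γ ∧
  ∀ ⦃v u w v' u' w' : V⦄, Is2Geodesic Γ v u w → Is2Geodesic Γ v' u' w' →
    ∃ φ : Γ ≃g Γ, φ v = v' ∧ φ u = u' ∧ φ w = w'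

/-- The permutation matrix of the translation `x ↦ x + t` of `ZMod p`. -/
def translationMatrix (p q : ℕ) (t : ZMod p) : Matrix (ZMod p) (ZMod p) (ZMod q) :=
  Matrix.of fun x y => if y - x = t then 1 else 0

theorem translationMatrix_mul (p q : ℕ) [NeZero p] (s t : ZMod p) :
    translationMatrix p q s * translationMatrix p q t = translationMatrix p q (s + t) := by
  ext x y
  simp only [translationMatrix, Matrix.mul_apply, Matrix.of_apply]
  rw [Finset.sum_eq_single (x + s)]
  · simp only [add_sub_cancel_left, if_true, one_mul]
    congr 1
    rw [eq_iff_iff]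
    constructor <;> intro h <;> linear_combination h
  · intro z _ hz
    rw [if_neg, zero_mul]
    rintro rfl
    exact hz (by ring)
  · simp

theorem translationMatrix_pow (p q : ℕ) [NeZero p] (t : ZMod p) (n : ℕ) :
    translationMatrix p q t ^ n = translationMatrix p q (n * t) := by
  induction n with
  | zero =>
    ext x y
    simp [translationMatrix, Matrix.one_apply, sub_eq_zero, eq_comm]
  | succ n ih => rw [pow_succ, ih, translationMatrix_mul]; push_cast; ring_nf

theorem sum_translationMatrix_pow (p q : ℕ) [NeZero p] [Fact q.Prime] (T : Finset (ZMod p)) :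
    (∑ t ∈ T, translationMatrix p q t) ^ q = ∑ t ∈ T, translationMatrix p q (q * t) := by
  induction T using Finset.induction_on with
  | empty => simp [(Fact.out : q.Prime).ne_zero]
  | insert a T ha ih =>
    rw [Finset.sum_insert ha, Finset.sum_insert ha, add_pow_char_of_commute, ih,
      translationMatrix_pow]
    refine Commute.sum_right _ _ _ fun t _ => ?_
    rw [Commute, SemiconjBy, translationMatrix_mul, translationMatrix_mul, add_comm]

theorem sum_translationMatrix_apply (p q : ℕ) [Fact p.Prime] (T : Finset (ZMod p))
    {c : ZMod p} (hc : c ≠ 0) (x y : ZMod p) :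
    (∑ t ∈ T, translationMatrix p q (c * t)) x y = if c⁻¹ * (y - x) ∈ T then 1 else 0 := by
  rw [Matrix.sum_apply]
  have : ∀ t, y - x = c * t ↔ c⁻¹ * (y - x) = t := fun t => by
    rw [inv_mul_eq_iff_eq_mul₀ hc]
  simp [translationMatrix, this]

/-- Schur: a permutation preserving a circulant relation on `ZMod p` preserves its dilation
by a prime. -/
theorem circulant_dilate_prime {p q : ℕ} [Fact p.Prime] [Fact q.Prime] (hq : (q : ZMod p) ≠ 0)
    (T : Finset (ZMod p)) (g : Equiv.Perm (ZMod p))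
    (hg : ∀ x y, g y - g x ∈ T ↔ y - x ∈ T) (x y : ZMod p) :
    (q : ZMod p)⁻¹ * (g y - g x) ∈ T ↔ (q : ZMod p)⁻¹ * (y - x) ∈ T := by
  set M := ∑ t ∈ T, translationMatrix p q t with hM
  have hMapp : ∀ x y, M x y = if y - x ∈ T then 1 else 0 := fun x y => by
    simpa using sum_translationMatrix_apply p q T one_ne_zero x y
  have hsub : Matrix.reindexAlgEquiv (ZMod q) (ZMod q) g.symm M = M := by
    ext x y
    simp [hMapp, hg]
  have hpow : Matrix.reindexAlgEquiv (ZMod q) (ZMod q) g.symm (M ^ q) = M ^ q := by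
    rw [map_pow, hsub]
  have := congrFun (congrFun hpow x) y
  rw [hM, sum_translationMatrix_pow] at this
  simp only [Matrix.coe_reindexAlgEquiv, Matrix.reindex_apply, Matrix.submatrix_apply,
    Equiv.symm_symm, sum_translationMatrix_apply p q T hq] at this
  split_ifs at this <;> simp_all

theorem circulant_dilate {p : ℕ} [Fact p.Prime] (T : Finset (ZMod p)) (g : Equiv.Perm (ZMod p))
    (hg : ∀ x y, g y - g x ∈ T ↔ y - x ∈ T) {c : ZMod p} (hc : c ≠ 0) (x y : ZMod p) :
    c⁻¹ * (g y - g x) ∈ T ↔ c⁻¹ * (y - x) ∈ T := by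
  suffices H : ∀ m : ℕ, (m : ZMod p) ≠ 0 →
      ∀ x y, (m : ZMod p)⁻¹ * (g y - g x) ∈ T ↔ (m : ZMod p)⁻¹ * (y - x) ∈ T by
    have := H c.val
    rw [ZMod.natCast_zmod_val] at this
    exact this hc x y
  intro m
  induction m using induction_on_primes with
  | zero => simp
  | one => simpa using hg
  | prime_mul q a hq ih =>
    intro h
    have := Fact.mk hq
    push_cast at h
    have hq0 := left_ne_zero_of_mul h
    have ha0 := right_ne_zero_of_mul h
    intro x y
    have := circulant_dilate_prime hq0 (Finset.univ.filter fun z => (a : ZMod p)⁻¹ * z ∈ T) g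
      (by simpa using ih ha0) x y
    simpa [mul_inv_rev, mul_assoc] using this

/-- An arc-transitive circulant on `ZMod p` has valency dividing `p - 1`. -/
theorem card_dvd_of_circulant_arc_transitive {p : ℕ} [Fact p.Prime] (T : Finset (ZMod p))
    (h0 : (0 : ZMod p) ∉ T) (hne : T.Nonempty)
    (htrans : ∀ s ∈ T, ∀ t ∈ T, ∃ g : Equiv.Perm (ZMod p),
      (∀ x y, g y - g x ∈ T ↔ y - x ∈ T) ∧ g 0 = 0 ∧ g s = t) :
    T.card ∣ p - 1 := by
  obtain ⟨a, ha⟩ := hne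
  have ha0 : a ≠ 0 := fun h => h0 (h ▸ ha)
  have key : ∀ c : ZMod p, c ≠ 0 → ∀ s ∈ T, c * s ∈ T → ∀ t ∈ T, c * t ∈ T := by
    intro c hc s hs hcs t ht
    obtain ⟨g, hg, hg0, hgs⟩ := htrans s hs t ht
    have := circulant_dilate T g hg (inv_ne_zero hc) 0 s
    simp only [inv_inv, hg0, hgs, sub_zero] at this
    exact this.2 hcs
  let H : Subgroup (ZMod p)ˣ :=
    { carrier := {c | (c : ZMod p) * a ∈ T}
      one_mem' := by simpa using ha
      mul_mem' := fun {b c} hb hc => by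
        have := key b b.ne_zero a ha hb _ hc
        rwa [← mul_assoc, ← Units.val_mul] at this
      inv_mem' := fun {b} hb => by
        have := key (b⁻¹ : (ZMod p)ˣ) (Units.ne_zero _) _ hb
          (by rwa [← mul_assoc, Units.inv_mul, one_mul]) a ha
        exact this }
  have hcard : Nat.card H = T.card := by
    rw [← Fintype.card_coe T, ← Nat.card_eq_fintype_card]
    refine Nat.card_congr
      { toFun := fun c => ⟨(c : (ZMod p)ˣ) * a, c.2⟩
        invFun := fun t => ⟨Units.mk0 (t * a⁻¹) (mul_ne_zero (fun h => h0 (h ▸ t.2))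
          (inv_ne_zero ha0)), ?_⟩
        left_inv := ?_
        right_inv := ?_ }
    · simp [H, ha0]
    · intro c; ext; simp [ha0]
    · intro c; ext; simp [ha0]
  rw [← hcard, ← ZMod.card_units p, ← Nat.card_eq_fintype_card]
  exact H.card_subgroup_dvd_card


/-- A vertex-transitive relation on a set of prime size is circulant. -/
theorem exists_circulant_labelling {p : ℕ} [Fact p.Prime] {X : Type*} (hX : Nat.card X = p)
    (R : X → X → Prop)
    (htr : ∀ x y, ∃ g : Equiv.Perm X, (∀ a b, R (g a) (g b) ↔ R a b) ∧ g x = y) (x₀ : X) :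
    ∃ e : ZMod p ≃ X, e 0 = x₀ ∧ ∀ x y, R (e x) (e y) ↔ R (e 0) (e (y - x)) := by
  classical
  have hp : p.Prime := Fact.out
  have : Finite X := Nat.finite_of_card_ne_zero (hX ▸ hp.ne_zero)
  have : Fintype X := Fintype.ofFinite X
  have hXF : Fintype.card X = p := by rw [← Nat.card_eq_fintype_card, hX]
  let G : Subgroup (Equiv.Perm X) :=
    { carrier := {g | ∀ a b, R (g a) (g b) ↔ R a b}
      one_mem' := fun a b => Iff.rfl
      mul_mem' := fun {g h} hg hh a b => (hg _ _).trans (hh a b)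
      inv_mem' := fun {g} hg a b => by simpa using (hg (g⁻¹ a) (g⁻¹ b)).symm }
  have : MulAction.IsPretransitive G X := ⟨fun x y => by
    obtain ⟨g, hg, h⟩ := htr x y
    exact ⟨⟨g, hg⟩, h⟩⟩
  have hdvd : p ∣ Nat.card G := by
    rw [← hX, ← MulAction.index_stabilizer_of_transitive G x₀]
    exact Subgroup.index_dvd_card _
  obtain ⟨⟨σ, hσG⟩, hσ⟩ := exists_prime_orderOf_dvd_card' p hdvd
  have hσ : orderOf σ = p := by rw [← hσ, Subgroup.orderOf_mk]
  have hcyc : σ.IsCycle :=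
    Equiv.Perm.isCycle_of_prime_order'' (hXF ▸ hp) (by rw [hσ, hXF])
  have hsupp : σ.support = Finset.univ := by
    rw [← Finset.card_eq_iff_eq_univ, ← hcyc.orderOf, hσ, hXF]
  have hmove : ∀ x, σ x ≠ x := fun x => by
    rw [← Equiv.Perm.mem_support, hsupp]; exact Finset.mem_univ x
  have hpow : ∀ n : ℕ, σ ^ (n % p) = σ ^ n := fun n => by rw [← pow_mod_orderOf σ n, hσ]
  let f : ZMod p → X := fun i => (σ ^ i.val) x₀
  have hf : ∀ i j, f (i + j) = (σ ^ i.val) (f j) := fun i j => by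
    simp only [f]
    rw [← Equiv.Perm.mul_apply, ← pow_add, ZMod.val_add, hpow]
  have hsurj : Function.Surjective f := fun x => by
    obtain ⟨n, hn⟩ := hcyc.exists_pow_eq (hmove x₀) (hmove x)
    refine ⟨n, ?_⟩
    simp only [f]
    rw [ZMod.val_natCast, hpow, hn]
  have hbij : Function.Bijective f :=
    (Fintype.bijective_iff_surjective_and_card f).2 ⟨hsurj, by rw [hXF, ZMod.card]⟩
  refine ⟨Equiv.ofBijective f hbij, by simp [f], fun x y => ?_⟩
  have h := (pow_mem hσG x.val : σ ^ x.val ∈ G) (f 0) (f (y - x))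
  rw [← hf, ← hf, add_zero, add_sub_cancel] at h
  exact h

/-- The valency of an arc-transitive irreflexive relation on a set of prime size `p` divides
`p - 1`. -/
theorem valency_dvd_of_arc_transitive {p : ℕ} [Fact p.Prime] {X : Type*} (hX : Nat.card X = p)
    (R : X → X → Prop) (hirr : ∀ x, ¬ R x x)
    (htr : ∀ x y, ∃ g : Equiv.Perm X, (∀ a b, R (g a) (g b) ↔ R a b) ∧ g x = y)
    (harc : ∀ x y z, R x y → R x z →
      ∃ g : Equiv.Perm X, (∀ a b, R (g a) (g b) ↔ R a b) ∧ g x = x ∧ g y = z)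
    (x y : X) (hxy : R x y) : Nat.card {z // R x z} ∣ p - 1 := by
  classical
  obtain ⟨e, rfl, he⟩ := exists_circulant_labelling hX R htr x
  let T : Finset (ZMod p) := Finset.univ.filter fun t => R (e 0) (e t)
  have hT : ∀ t, t ∈ T ↔ R (e 0) (e t) := by simp [T]
  have hcard : Nat.card {z // R (e 0) z} = T.card := by
    rw [← Fintype.card_coe T, ← Nat.card_eq_fintype_card]
    exact (Nat.card_congr (e.subtypeEquiv hT)).symm
  rw [hcard]
  refine card_dvd_of_circulant_arc_transitive T (by simpa [hT] using hirr _)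
    ⟨e.symm y, by simpa [hT] using hxy⟩ fun s hs t ht => ?_
  obtain ⟨g, hg, hg0, hgs⟩ := harc _ _ _ ((hT s).1 hs) ((hT t).1 ht)
  refine ⟨(e.trans g).trans e.symm, fun a b => ?_, by simp [hg0], by simp [hgs]⟩
  rw [hT, hT, ← he, ← he]
  simp [hg]

/-- A nonempty vertex-transitive relation on a set of prime size whose reflexive closure is
transitive relates all pairs of distinct elements. -/
theorem rel_of_ne_of_transitive {p : ℕ} [Fact p.Prime] {X : Type*} (hX : Nat.card X = p)
    (R : X → X → Prop)
    (htr : ∀ x y, ∃ g : Equiv.Perm X, (∀ a b, R (g a) (g b) ↔ R a b) ∧ g x = y)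
    (hR : ∀ x y z, R x y → R y z → x ≠ z → R x z)
    (x y : X) (hxy : R x y) (hne : x ≠ y) (z : X) (hz : x ≠ z) : R x z := by
  obtain ⟨e, rfl, he⟩ := exists_circulant_labelling hX R htr x
  obtain ⟨t, rfl⟩ := e.surjective y
  obtain ⟨s, rfl⟩ := e.surjective z
  have ht : t ≠ 0 := fun h => hne (by rw [h])
  have key : ∀ n : ℕ, e 0 = e (n * t) ∨ R (e 0) (e (n * t)) := by
    intro n
    induction n with
    | zero => simp
    | succ n ih =>
      by_cases h : e 0 = e ((n + 1 : ℕ) * t)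
      · exact Or.inl h
      refine Or.inr ?_
      have hstep : R (e (n * t)) (e ((n + 1 : ℕ) * t)) := by
        rw [he]; push_cast; ring_nf; exact hxy
      rcases ih with h' | h'
      · rwa [← h'] at hstep
      · exact hR _ _ _ h' hstep h
  have := key (s * t⁻¹).val
  rw [ZMod.natCast_zmod_val, inv_mul_cancel_right₀ ht] at this
  exact this.resolve_left hz

open Classical in
/-- The endpoints of the 2-geodesics starting with the arc `(v,u)`. -/
noncomputable def geodesicEnds {V : Type*} [Fintype V] (Γ : SimpleGraph V) (v u : V) : Finset V :=
  Finset.univ.filter fun x => Is2Geodesic Γ v u x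

theorem mem_geodesicEnds {V : Type*} [Fintype V] {Γ : SimpleGraph V} {v u x : V} :
    x ∈ geodesicEnds Γ v u ↔ Is2Geodesic Γ v u x := by
  simp [geodesicEnds]

open Classical in
/-- The common neighbours of `v` and `w`. -/
noncomputable def commonNbrs {V : Type*} [Fintype V] (Γ : SimpleGraph V) (v w : V) : Finset V :=
  Finset.univ.filter fun x => Γ.Adj v x ∧ Γ.Adj w x

theorem mem_commonNbrs {V : Type*} [Fintype V] {Γ : SimpleGraph V} {v w x : V} :
    x ∈ commonNbrs Γ v w ↔ Γ.Adj v x ∧ Γ.Adj w x := by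
  simp [commonNbrs]

theorem card_neighborFinset_eq {V : Type*} {Γ : SimpleGraph V} {p : ℕ}
    (hreg : ∀ v : V, Nat.card (Γ.neighborSet v) = p) (v : V) [Fintype (Γ.neighborSet v)] :
    (Γ.neighborFinset v).card = p := by
  rw [card_neighborFinset_eq_degree, ← card_neighborSet_eq_degree, ← Nat.card_eq_fintype_card,
    hreg]

theorem is2Geodesic_iff_dist {V : Type*} {Γ : SimpleGraph V} {v u x : V} (h : Γ.Adj v u) :
    Is2Geodesic Γ v u x ↔ Γ.Adj u x ∧ Γ.dist v x = 2 := by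
  refine ⟨fun ⟨_, hux, hne, hna⟩ => ⟨hux, ?_⟩, fun ⟨hux, hd⟩ => ⟨h, hux, ?_, fun hvx => ?_⟩⟩
  · have hle : Γ.dist v x ≤ 2 := dist_le (Walk.cons h (Walk.cons hux Walk.nil))
    have h0 : 0 < Γ.dist v x := (h.reachable.trans hux.reachable).pos_dist_of_ne hne
    have h1 : Γ.dist v x ≠ 1 := fun h1 => hna (dist_eq_one_iff_adj.1 h1)
    omega
  · rintro rfl
    simp at hd
  · rw [dist_eq_one_iff_adj.2 hvx] at hd
    omega

theorem exists_is2Geodesic {V : Type*} {Γ : SimpleGraph V} (hconn : Γ.Connected) (hnc : Γ ≠ ⊤) :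
    ∃ v u w, Is2Geodesic Γ v u w := by
  by_contra! hno
  refine hnc (eq_top_iff.2 fun a b hab => ?_)
  obtain ⟨W⟩ := hconn.preconnected a b
  have key : ∀ {a b : V}, Γ.Walk a b → a = b ∨ Γ.Adj a b := by
    intro a b W
    induction W with
    | nil => exact Or.inl rfl
    | @cons a c b hac _ ih =>
      rcases ih with rfl | hcb
      · exact Or.inr hac
      · by_contra! hcon
        exact hno a c b ⟨hac, hcb, hcon.1, hcon.2⟩
  exact (key W).resolve_left hab

theorem is2Geodesic_map {V : Type*} {Γ : SimpleGraph V} (φ : Γ ≃g Γ) {v u w : V} :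
    Is2Geodesic Γ (φ v) (φ u) (φ w) ↔ Is2Geodesic Γ v u w := by
  simp [Is2Geodesic, φ.map_adj_iff]

theorem card_geodesicEnds_eq {V : Type*} [Fintype V] {Γ : SimpleGraph V} (h : ArcTransitive Γ)
    {v u v' u' : V} (hvu : Γ.Adj v u) (hvu' : Γ.Adj v' u') :
    (geodesicEnds Γ v u).card = (geodesicEnds Γ v' u').card := by
  obtain ⟨φ, rfl, rfl⟩ := h hvu hvu'
  refine Finset.card_equiv φ.toEquiv fun x => ?_
  rw [mem_geodesicEnds, mem_geodesicEnds]
  exact (is2Geodesic_map φ).symm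

theorem card_commonNbrs_eq {V : Type*} [Fintype V] {Γ : SimpleGraph V}
    (h : TwoGeodesicTransitive Γ) {v u w v' u' w' : V} (hg : Is2Geodesic Γ v u w)
    (hg' : Is2Geodesic Γ v' u' w') :
    (commonNbrs Γ v w).card = (commonNbrs Γ v' w').card := by
  obtain ⟨φ, rfl, rfl, rfl⟩ := h.2 hg hg'
  refine Finset.card_equiv φ.toEquiv fun x => ?_
  rw [mem_commonNbrs, mem_commonNbrs]
  exact (and_congr φ.map_adj_iff φ.map_adj_iff).symm

/-- Double counting the edges between the first and second neighbourhoods of a vertex. -/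
theorem exists_card_mul_eq {V : Type*} [Fintype V] {Γ : SimpleGraph V} {p : ℕ}
    (hreg : ∀ v : V, Nat.card (Γ.neighborSet v) = p) (h : TwoGeodesicTransitive Γ)
    {v u w : V} (hg : Is2Geodesic Γ v u w) :
    ∃ n, p * (geodesicEnds Γ v u).card = n * (commonNbrs Γ v w).card := by
  classical
  have hdeg : (Γ.neighborFinset v).card = p := card_neighborFinset_eq hreg _
  refine ⟨(Finset.univ.filter fun y => ∃ x, Is2Geodesic Γ v x y).card, ?_⟩
  rw [← hdeg]
  refine Finset.card_mul_eq_card_mul Γ.Adj (fun x hx => ?_) fun y hy => ?_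
  · rw [mem_neighborFinset] at hx
    rw [← card_geodesicEnds_eq h.1 hx hg.1]
    congr 1
    ext y
    simp only [Finset.mem_bipartiteAbove, Finset.mem_filter, Finset.mem_univ, true_and,
      mem_geodesicEnds]
    exact ⟨fun ⟨⟨_, hy⟩, hxy⟩ => ⟨hx, hxy, hy.2.2⟩, fun hy => ⟨⟨x, hy⟩, hy.2.1⟩⟩
  · obtain ⟨x, hx⟩ := (Finset.mem_filter.1 hy).2
    rw [← card_commonNbrs_eq h hx hg]
    congr 1
    ext z
    simp [Finset.mem_bipartiteBelow, mem_commonNbrs, Γ.adj_comm z y]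

/-- Inclusion-exclusion in the neighbourhood of the middle vertex of a 2-geodesic. -/
theorem add_one_le_card_commonNbrs {V : Type*} [Fintype V] {Γ : SimpleGraph V} {p : ℕ}
    (hreg : ∀ v : V, Nat.card (Γ.neighborSet v) = p) (h : ArcTransitive Γ)
    {v u w : V} (hg : Is2Geodesic Γ v u w) :
    p + 1 ≤ (commonNbrs Γ v w).card + 2 * (geodesicEnds Γ v u).card := by
  classical
  have hdeg : (Γ.neighborFinset u).card = p := card_neighborFinset_eq hreg _
  have hwu : Γ.Adj w u := hg.2.1.symm
  have hgw : Is2Geodesic Γ w u v :=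
    ⟨hwu, hg.1.symm, hg.2.2.1.symm, fun h => hg.2.2.2 h.symm⟩
  have hK : (geodesicEnds Γ w u).card = (geodesicEnds Γ v u).card :=
    card_geodesicEnds_eq h hwu hg.1
  have hunion : (geodesicEnds Γ v u ∪ geodesicEnds Γ w u).card ≤
      2 * (geodesicEnds Γ v u).card := by
    refine (Finset.card_union_le _ _).trans ?_
    omega
  have hsub : insert u (Γ.neighborFinset u) ⊆
      commonNbrs Γ v w ∪ (geodesicEnds Γ v u ∪ geodesicEnds Γ w u) := by
    intro x hx
    rw [Finset.mem_insert, mem_neighborFinset] at hx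
    simp only [Finset.mem_union, mem_commonNbrs, mem_geodesicEnds]
    rcases hx with rfl | hx
    · exact Or.inl ⟨hg.1, hwu⟩
    by_cases hxv : v = x
    · exact hxv ▸ Or.inr (Or.inr hgw)
    by_cases hxw : w = x
    · exact hxw ▸ Or.inr (Or.inl hg)
    by_cases h1 : Γ.Adj v x
    · by_cases h2 : Γ.Adj w x
      · exact Or.inl ⟨h1, h2⟩
      · exact Or.inr (Or.inr ⟨hwu, hx, hxw, h2⟩)
    · exact Or.inr (Or.inl ⟨hg.1, hx, hxv, h1⟩)
  have hcard := (Finset.card_le_card hsub).trans (Finset.card_union_le _ _)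
  rw [Finset.card_insert_of_notMem (by simp), hdeg] at hcard
  omega

/-- An automorphism fixing `u` acts on the neighbours of `u` preserving non-adjacency. -/
theorem exists_perm_neighborSet {V : Type*} {Γ : SimpleGraph V} (φ : Γ ≃g Γ) {u : V}
    (hφ : φ u = u) :
    ∃ g : Equiv.Perm (Γ.neighborSet u), (∀ a, (g a : V) = φ a) ∧
      ∀ a b, Is2Geodesic Γ (g a : V) u (g b) ↔ Is2Geodesic Γ (a : V) u b := by
  have hmem : ∀ x, Γ.Adj u (φ x) ↔ Γ.Adj u x := fun x => by
    conv_lhs => rw [← hφ, φ.map_adj_iff]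
  refine ⟨Equiv.Perm.subtypePerm φ.toEquiv hmem, fun _ => rfl, fun a b => ?_⟩
  have := is2Geodesic_map φ (v := a) (u := u) (w := b)
  rw [hφ] at this
  exact this

theorem exists_perm_neighborSet_apply_eq {V : Type*} {Γ : SimpleGraph V} (h : ArcTransitive Γ)
    {u : V} (x y : Γ.neighborSet u) :
    ∃ g : Equiv.Perm (Γ.neighborSet u),
      (∀ a b, Is2Geodesic Γ (g a : V) u (g b) ↔ Is2Geodesic Γ (a : V) u b) ∧ g x = y := by
  obtain ⟨φ, hx, hu⟩ := h (Adj.symm x.2) (Adj.symm y.2)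
  obtain ⟨g, hg, hR⟩ := exists_perm_neighborSet φ hu
  exact ⟨g, hR, Subtype.ext ((hg x).trans hx)⟩

theorem card_geodesicEnds_dvd {V : Type*} [Fintype V] {Γ : SimpleGraph V} {p : ℕ}
    (hp : p.Prime) (hreg : ∀ v : V, Nat.card (Γ.neighborSet v) = p)
    (h : TwoGeodesicTransitive Γ) {v u w : V} (hg : Is2Geodesic Γ v u w) :
    (geodesicEnds Γ v u).card ∣ p - 1 := by
  have := Fact.mk hp
  have hdvd := valency_dvd_of_arc_transitive (hreg u)
    (fun a b : Γ.neighborSet u => Is2Geodesic Γ (a : V) u b) (fun x hx => hx.2.2.1 rfl)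
    (exists_perm_neighborSet_apply_eq h.1)
    (fun x y z hxy hxz => by
      obtain ⟨φ, hx, hu, hy⟩ := h.2 hxy hxz
      obtain ⟨g, hφ, hR⟩ := exists_perm_neighborSet φ hu
      exact ⟨g, hR, Subtype.ext ((hφ x).trans hx), Subtype.ext ((hφ y).trans hy)⟩)
    ⟨v, hg.1.symm⟩ ⟨w, hg.2.1⟩ hg
  convert hdvd using 1
  rw [← Fintype.card_coe, ← Nat.card_eq_fintype_card]
  exact Nat.card_congr
    { toFun := fun x => ⟨⟨x, (mem_geodesicEnds.1 x.2).2.1⟩, mem_geodesicEnds.1 x.2⟩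
      invFun := fun x => ⟨x.1, mem_geodesicEnds.2 x.2⟩
      left_inv := fun _ => rfl
      right_inv := fun _ => rfl }

theorem geodesicEnds_subset_erase {V : Type*} [Fintype V] [DecidableEq V] {Γ : SimpleGraph V}
    [DecidableRel Γ.Adj] (v u : V) :
    geodesicEnds Γ v u ⊆ (Γ.neighborFinset u).erase v := fun x hx => by
  have hx := mem_geodesicEnds.1 hx
  exact Finset.mem_erase.2 ⟨hx.2.2.1.symm, (mem_neighborFinset _ _ _).2 hx.2.1⟩

theorem card_geodesicEnds_lt {V : Type*} [Fintype V] {Γ : SimpleGraph V} {p : ℕ}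
    (hreg : ∀ v : V, Nat.card (Γ.neighborSet v) = p)
    (h : TwoGeodesicTransitive Γ) (h2 : ¬ TwoArcTransitive Γ) {v u : V} (hvu : Γ.Adj v u) :
    (geodesicEnds Γ v u).card < p - 1 := by
  classical
  have hdeg : ∀ v u, Γ.Adj v u → ((Γ.neighborFinset u).erase v).card = p - 1 := fun v u hvu => by
    rw [Finset.card_erase_of_mem ((mem_neighborFinset _ _ _).2 hvu.symm),
      card_neighborFinset_eq hreg]
  by_contra! hle
  have key : ∀ v u w, Is2Arc Γ v u w → Is2Geodesic Γ v u w := by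
    intro x y z hxyz
    have heq := Finset.eq_of_subset_of_card_le (geodesicEnds_subset_erase (Γ := Γ) x y)
      (by rw [hdeg x y hxyz.1, card_geodesicEnds_eq h.1 hxyz.1 hvu]; exact hle)
    rw [← mem_geodesicEnds, heq, Finset.mem_erase, mem_neighborFinset]
    exact ⟨hxyz.2.2.symm, hxyz.2.1⟩
  exact h2 ⟨h.1, fun _ _ _ _ _ _ ha hb => h.2 (key _ _ _ ha) (key _ _ _ hb)⟩

/-- Vertices at distance two have fewer than `p` common neighbours. -/
theorem card_commonNbrs_lt {V : Type*} [Fintype V] {Γ : SimpleGraph V} {p : ℕ}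
    (hp : p.Prime) (hreg : ∀ v : V, Nat.card (Γ.neighborSet v) = p)
    (h : TwoGeodesicTransitive Γ) (h2 : ¬ TwoArcTransitive Γ) {v u w : V}
    (hg : Is2Geodesic Γ v u w) :
    (commonNbrs Γ v w).card < p := by
  classical
  have := Fact.mk hp
  have hdeg : ∀ v, (Γ.neighborFinset v).card = p := fun v => card_neighborFinset_eq hreg v
  by_contra! hle
  have htwin : ∀ {x y z t}, Is2Geodesic Γ x y z → Γ.Adj x t → Γ.Adj z t := by
    intro x y z t hxyz hxt
    have heq : commonNbrs Γ x z = Γ.neighborFinset x :=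
      Finset.eq_of_subset_of_card_le
        (fun a ha => (mem_neighborFinset _ _ _).2 (mem_commonNbrs.1 ha).1)
        (by rw [hdeg, card_commonNbrs_eq h hxyz hg]; exact hle)
    rw [← mem_neighborFinset, ← heq] at hxt
    exact (mem_commonNbrs.1 hxt).2
  have hall := rel_of_ne_of_transitive (hreg u)
    (fun a b : Γ.neighborSet u => Is2Geodesic Γ (a : V) u b)
    (exists_perm_neighborSet_apply_eq h.1)
    (fun x y z hxy hyz hxz => ⟨hxy.1, hyz.2.1, fun h => hxz (Subtype.ext h),
      fun hadj => hyz.2.2.2 (htwin hxy hadj)⟩)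
    ⟨v, hg.1.symm⟩ ⟨w, hg.2.1⟩ hg (fun h => hg.2.2.1 (congrArg Subtype.val h))
  have hsub : (Γ.neighborFinset u).erase v ⊆ geodesicEnds Γ v u := fun x hx => by
    rw [Finset.mem_erase, mem_neighborFinset] at hx
    exact mem_geodesicEnds.2 (hall ⟨x, hx.2⟩ fun h => hx.1 (congrArg Subtype.val h).symm)
  have hcard := Finset.card_le_card hsub
  rw [Finset.card_erase_of_mem ((mem_neighborFinset _ _ _).2 hg.1.symm), hdeg] at hcard
  exact (card_geodesicEnds_lt hreg h h2 hg.1).not_ge hcard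


theorem stmt2 {V : Type*} [Fintype V] (Γ : SimpleGraph V) (p : ℕ)
    (hp : p.Prime)
    (hreg : ∀ v : V, Nat.card (Γ.neighborSet v) = p)
    (hconn : Γ.Connected)
    (hnc : Γ ≠ ⊤)
    (h2gt : TwoGeodesicTransitive Γ)
    (h2at : ¬ TwoArcTransitive Γ) :
    ∀ v u : V, Γ.Adj v u →
      Nat.card {x : V | Γ.Adj u x ∧ Γ.dist v x = 2} = (p - 1) / 2 := by
  intro v u hvu
  obtain ⟨a, b, c, hg⟩ := exists_is2Geodesic hconn hnc
  have hcard : Nat.card {x : V | Γ.Adj u x ∧ Γ.dist v x = 2} = (geodesicEnds Γ a b).card := by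
    rw [card_geodesicEnds_eq h2gt.1 hg.1 hvu, ← Fintype.card_coe, ← Nat.card_eq_fintype_card]
    exact Nat.card_congr (Equiv.subtypeEquivRight fun x =>
      (mem_geodesicEnds.trans (is2Geodesic_iff_dist hvu)).symm)
  rw [hcard]
  have hpos : 0 < (geodesicEnds Γ a b).card :=
    Finset.card_pos.2 ⟨c, mem_geodesicEnds.2 hg⟩
  have hcpos : 0 < (commonNbrs Γ a c).card :=
    Finset.card_pos.2 ⟨b, mem_commonNbrs.2 ⟨hg.1, hg.2.1.symm⟩⟩
  have hlt := card_geodesicEnds_lt hreg h2gt h2at hg.1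
  have hclt := card_commonNbrs_lt hp hreg h2gt h2at hg
  have hle := add_one_le_card_commonNbrs hreg h2gt.1 hg
  obtain ⟨m, hm⟩ := card_geodesicEnds_dvd hp hreg h2gt hg
  obtain ⟨n, hn⟩ := exists_card_mul_eq hreg h2gt hg
  set k := (geodesicEnds Γ a b).card
  set d := (commonNbrs Γ a c).card
  have hdk : d ≤ k := Nat.le_of_dvd hpos <|
    (Nat.coprime_of_lt_prime hcpos.ne' hclt hp).symm.dvd_of_dvd_mul_left ⟨n, by rw [hn, mul_comm]⟩
  have hm2 : m = 2 := by
    have : m < 3 := by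
      by_contra! h
      have := Nat.mul_le_mul_left k h
      omega
    interval_cases m <;> omega
  subst hm2
  omega
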